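/- arXiv:2305.20033 — 5 statements merged into one kernel-verified Lean document; each statement's English description precedes it below -/
import Mathlib

section
/- Let 𝒰 ⊂ ℝ^m be a finite set with 0 ∈ 𝒰 and let δ > 0 be such that the Voronoi cell of 0 satisfies V_𝒰(0) ⊆ {x ∈ ℝ^m : ‖x‖ ≤ δ}. If y ∈ ℝ^m satisfies ‖y‖ > δ and u ∈ 𝒰 is a nearest point of 𝒰 to −y, then u ≠ 0 and ⟨u, y⟩ ≤ −(1/2)‖u‖² < 0. -/
/-- If the Voronoi cell of `0` in the finite set `𝒰 ∋ 0` is contained in the closed ball of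
radius `δ > 0` and `‖y‖ > δ`, then any nearest point `u ∈ 𝒰` to `−y` is nonzero and satisfies
`⟨u, y⟩ ≤ −(1/2)‖u‖² < 0`. -/
theorem nearest_neighbor_strict_decrease (m : ℕ) (U : Finset (EuclideanSpace ℝ (Fin m)))
    (h0U : (0 : EuclideanSpace ℝ (Fin m)) ∈ U) (δ : ℝ) (hδ : 0 < δ)
    (hVor : {x : EuclideanSpace ℝ (Fin m) | ∀ v ∈ U, ‖x‖ ≤ ‖x - v‖} ⊆ Metric.closedBall 0 δ)
    (y u : EuclideanSpace ℝ (Fin m)) (hy : ‖y‖ > δ) (huU : u ∈ U)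
    (hnear : ∀ v ∈ U, ‖u - (-y)‖ ≤ ‖v - (-y)‖) :
    u ≠ 0 ∧ (inner ℝ u y : ℝ) ≤ -(1 / 2) * ‖u‖ ^ 2 ∧ -(1 / 2) * ‖u‖ ^ 2 < 0 := by
  have hu : u ≠ 0 := by
    rintro rfl
    have hmem : -y ∈ Metric.closedBall (0 : EuclideanSpace ℝ (Fin m)) δ :=
      hVor fun v hv => by simpa [norm_sub_rev (-y) v, add_comm] using hnear v hv
    rw [mem_closedBall_zero_iff, norm_neg] at hmem
    exact hy.not_ge hmem
  have hle : ‖u + y‖ ≤ ‖y‖ := by simpa using hnear 0 h0U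
  have hsq : ‖u + y‖ ^ 2 ≤ ‖y‖ ^ 2 := by gcongr
  rw [norm_add_sq_real] at hsq
  have hpos : 0 < ‖u‖ ^ 2 := by positivity
  exact ⟨hu, by linarith, by linarith⟩
end

section
/- Let B be a real N × M matrix and for each i = 1, …, N let 𝒰_i ⊂ ℝ^m be a finite set with 0 ∈ 𝒰_i. Let z = (z_1, …, z_M) with z_k ∈ ℝ^m be a block vector, let y_i denote the i-th block of (B⊗I_m)z, and let u_i ∈ 𝒰_i be a nearest point of 𝒰_i to −y_i for each i. Then ⟨z, (Bᵀ⊗I_m)u⟩ = Σ_{i=1}^N ⟨y_i, u_i⟩ ≤ −(1/2) Σ_{i=1}^N ‖u_i‖² ≤ 0. -/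
/-- If `u` is at least as close to `-y` as the origin is, then `⟪y, u⟫ ≤ -‖u‖² / 2`. -/
theorem inner_le_neg_half_norm_sq_of_norm_sub_neg_le {E : Type*} [NormedAddCommGroup E]
    [InnerProductSpace ℝ E] {y u : E} (h : ‖u - (-y)‖ ≤ ‖y‖) :
    inner ℝ y u ≤ -(1 / 2) * ‖u‖ ^ 2 := by
  rw [sub_neg_eq_add] at h
  have hsq := pow_le_pow_left₀ (norm_nonneg _) h 2
  rw [norm_add_sq_real, real_inner_comm] at hsq
  linarith

/-- The adjoint of `B ⊗ I` is `Bᵀ ⊗ I`. -/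
theorem sum_inner_sum_smul_comm {ι κ E : Type*} [Fintype ι] [Fintype κ] [NormedAddCommGroup E]
    [InnerProductSpace ℝ E] (B : Matrix ι κ ℝ) (z : κ → E) (u : ι → E) :
    ∑ k, inner ℝ (z k) (∑ i, B i k • u i) = ∑ i, inner ℝ (∑ k, B i k • z k) (u i) := by
  simp only [inner_sum, sum_inner, real_inner_smul_left, real_inner_smul_right]
  exact Finset.sum_comm

/-- Lyapunov decrease inequality for the nearest-neighbor consensus dynamics: with
`y_i` the `i`-th block of `(B⊗I_m)z` and `u_i` a nearest point of `𝒰_i` to `−y_i`,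
`⟨z, (Bᵀ⊗I_m)u⟩ = Σ_i ⟨y_i, u_i⟩ ≤ −(1/2)Σ_i ‖u_i‖² ≤ 0`. -/
theorem consensus_lyapunov_decrease (N M m : ℕ) (B : Matrix (Fin N) (Fin M) ℝ)
    (U : Fin N → Finset (EuclideanSpace ℝ (Fin m)))
    (hU0 : ∀ i, (0 : EuclideanSpace ℝ (Fin m)) ∈ U i)
    (z : Fin M → EuclideanSpace ℝ (Fin m))
    (y u : Fin N → EuclideanSpace ℝ (Fin m))
    (hy : ∀ i, y i = ∑ k, B i k • z k)
    (huU : ∀ i, u i ∈ U i)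
    (hnear : ∀ i, ∀ v ∈ U i, ‖u i - (-(y i))‖ ≤ ‖v - (-(y i))‖) :
    (∑ k, (inner ℝ (z k) (∑ i, B i k • u i) : ℝ)) = (∑ i, (inner ℝ (y i) (u i) : ℝ)) ∧
    (∑ i, (inner ℝ (y i) (u i) : ℝ)) ≤ -(1 / 2) * ∑ i, ‖u i‖ ^ 2 ∧
    -(1 / 2) * (∑ i, ‖u i‖ ^ 2) ≤ 0 := by
  refine ⟨?_, ?_, ?_⟩
  · simp only [hy, sum_inner_sum_smul_comm]
  · rw [Finset.mul_sum]
    refine Finset.sum_le_sum fun i _ => inner_le_neg_half_norm_sq_of_norm_sub_neg_le ?_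
    simpa using hnear i 0 (hU0 i)
  · have h : 0 ≤ ∑ i, ‖u i‖ ^ 2 := Finset.sum_nonneg fun i _ => sq_nonneg _
    linarith
end

section
/- Let B be a real N × M matrix and for each i = 1, …, N let 𝒰_i ⊂ ℝ^m be a finite set with 0 ∈ 𝒰_i, and let δ_i > 0 satisfy V_{𝒰_i}(0) ⊆ {x ∈ ℝ^m : ‖x‖ ≤ δ_i}. Let z = (z_1, …, z_M) with z_k ∈ ℝ^m, let y_i denote the i-th block of (B⊗I_m)z, and let u_i ∈ 𝒰_i be a nearest point of 𝒰_i to −y_i for each i. If ‖y_j‖ > δ_j for some index j, then Σ_{i=1}^N ⟨y_i, u_i⟩ ≤ −(1/2)‖u_j‖² < 0. -/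
/-- If adding `u` to `y` does not increase the norm, then `⟪y, u⟫ ≤ -‖u‖² / 2`. -/
theorem inner_le_of_norm_add_le {E : Type*} [NormedAddCommGroup E] [InnerProductSpace ℝ E]
    {y u : E} (h : ‖u + y‖ ≤ ‖y‖) : inner ℝ y u ≤ -(1 / 2) * ‖u‖ ^ 2 := by
  have hsq : ‖u + y‖ ^ 2 ≤ ‖y‖ ^ 2 := by gcongr
  rw [norm_add_sq_real, real_inner_comm] at hsq
  linarith

/-- Strict Lyapunov decrease outside the invariant set: if additionally
`V_{𝒰_i}(0) ⊆ closedBall 0 δ_i` for each `i` and `‖y_j‖ > δ_j` for some `j`, then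
`Σ_i ⟨y_i, u_i⟩ ≤ −(1/2)‖u_j‖² < 0`. -/
theorem consensus_lyapunov_strict_decrease (N M m : ℕ) (B : Matrix (Fin N) (Fin M) ℝ)
    (U : Fin N → Finset (EuclideanSpace ℝ (Fin m)))
    (hU0 : ∀ i, (0 : EuclideanSpace ℝ (Fin m)) ∈ U i)
    (δ : Fin N → ℝ) (hδ : ∀ i, 0 < δ i)
    (hVor : ∀ i, {x : EuclideanSpace ℝ (Fin m) | ∀ v ∈ U i, ‖x‖ ≤ ‖x - v‖}
      ⊆ Metric.closedBall 0 (δ i))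
    (z : Fin M → EuclideanSpace ℝ (Fin m))
    (y u : Fin N → EuclideanSpace ℝ (Fin m))
    (hy : ∀ i, y i = ∑ k, B i k • z k)
    (huU : ∀ i, u i ∈ U i)
    (hnear : ∀ i, ∀ v ∈ U i, ‖u i - (-(y i))‖ ≤ ‖v - (-(y i))‖)
    (j : Fin N) (hj : ‖y j‖ > δ j) :
    (∑ i, (inner ℝ (y i) (u i) : ℝ)) ≤ -(1 / 2) * ‖u j‖ ^ 2 ∧
    -(1 / 2) * ‖u j‖ ^ 2 < 0 := by
  have hterm (i) : inner ℝ (y i) (u i) ≤ -(1 / 2) * ‖u i‖ ^ 2 :=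
    inner_le_of_norm_add_le (by simpa using hnear i 0 (hU0 i))
  have huj : u j ≠ 0 := by
    intro h0
    have hmem : -(y j) ∈ Metric.closedBall 0 (δ j) := hVor j fun v hv => by
      rw [norm_sub_rev (-(y j)) v]
      simpa [h0] using hnear j v hv
    rw [mem_closedBall_zero_iff, norm_neg] at hmem
    exact hj.not_ge hmem
  refine ⟨?_, ?_⟩
  · rw [← Finset.add_sum_erase _ _ (Finset.mem_univ j)]
    have hrest : ∑ i ∈ Finset.univ.erase j, inner ℝ (y i) (u i) ≤ 0 :=
      Finset.sum_nonpos fun i _ => by nlinarith [hterm i, sq_nonneg ‖u i‖]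
    linarith [hterm j]
  · have : 0 < ‖u j‖ ^ 2 := by positivity
    linarith
end

section
/- Let B be a real N × M matrix and for each i = 1, …, N let 𝒰_i ⊂ ℝ^m be a finite set with 0 ∈ 𝒰_i. Let z_1, …, z_M ∈ ℝ^m and e ∈ ℝ^M, let w be the block vector with k-th block e_k z_k, let y_i denote the i-th block of (B⊗I_m)w, and let u_i ∈ 𝒰_i be a nearest point of 𝒰_i to −y_i for each i. Then Σ_{k=1}^M e_k ⟨z_k, ((Bᵀ⊗I_m)u)_k⟩ = Σ_{i=1}^N ⟨y_i, u_i⟩ ≤ −(1/2) Σ_{i=1}^N ‖u_i‖² ≤ 0. -/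
/-- Lyapunov decrease inequality for the distance-based formation Lyapunov function: with
`w` the block vector with blocks `e_k z_k`, `y_i` the `i`-th block of `(B⊗I_m)w`, and `u_i`
a nearest point of `𝒰_i` to `−y_i`,
`Σ_k e_k ⟨z_k, ((Bᵀ⊗I_m)u)_k⟩ = Σ_i ⟨y_i, u_i⟩ ≤ −(1/2)Σ_i ‖u_i‖² ≤ 0`. -/
theorem formation_lyapunov_decrease (N M m : ℕ) (B : Matrix (Fin N) (Fin M) ℝ)
    (U : Fin N → Finset (EuclideanSpace ℝ (Fin m)))
    (hU0 : ∀ i, (0 : EuclideanSpace ℝ (Fin m)) ∈ U i)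
    (z : Fin M → EuclideanSpace ℝ (Fin m)) (e : Fin M → ℝ)
    (w : Fin M → EuclideanSpace ℝ (Fin m)) (hw : ∀ k, w k = e k • z k)
    (y u : Fin N → EuclideanSpace ℝ (Fin m))
    (hy : ∀ i, y i = ∑ k, B i k • w k)
    (huU : ∀ i, u i ∈ U i)
    (hnear : ∀ i, ∀ v ∈ U i, ‖u i - (-(y i))‖ ≤ ‖v - (-(y i))‖) :
    (∑ k, e k * (inner ℝ (z k) (∑ i, B i k • u i) : ℝ)) = (∑ i, (inner ℝ (y i) (u i) : ℝ)) ∧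
    (∑ i, (inner ℝ (y i) (u i) : ℝ)) ≤ -(1 / 2) * ∑ i, ‖u i‖ ^ 2 ∧
    -(1 / 2) * (∑ i, ‖u i‖ ^ 2) ≤ 0 := by
  refine ⟨?_, ?_, ?_⟩
  · simp only [hy, hw, inner_sum, sum_inner, real_inner_smul_left, real_inner_smul_right,
      Finset.mul_sum]
    rw [Finset.sum_comm]
    exact Finset.sum_congr rfl fun i _ => Finset.sum_congr rfl fun k _ => by ring
  · rw [Finset.mul_sum]
    refine Finset.sum_le_sum fun i _ => ?_
    have h := hnear i 0 (hU0 i)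
    rw [sub_neg_eq_add, sub_neg_eq_add, zero_add] at h
    have hsq := pow_le_pow_left₀ (norm_nonneg _) h 2
    rw [norm_add_sq_real, real_inner_comm] at hsq
    linarith
  · have h : 0 ≤ ∑ i, ‖u i‖ ^ 2 := Finset.sum_nonneg fun i _ => sq_nonneg _
    linarith
end

section
/- Let B be a real N × M matrix and let z₀ ∈ ℝ^M lie in the range of the map x ↦ Bᵀ x. Then exp(−t BᵀB) z₀ → 0 as t → ∞. -/
open Matrix Filter Topology

/-- The flow of a real symmetric matrix in the coordinates of an orthonormal eigenbasis. -/
lemma Matrix.IsHermitian.exp_smul_eq {n : Type*} [Fintype n] [DecidableEq n]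
    {A : Matrix n n ℝ} (hA : A.IsHermitian) (t : ℝ) :
    NormedSpace.exp (t • A) = (hA.eigenvectorUnitary : Matrix n n ℝ) *
      diagonal (fun i => Real.exp (t * hA.eigenvalues i)) *
        star (hA.eigenvectorUnitary : Matrix n n ℝ) := by
  have h : t • A = (hA.eigenvectorUnitary : Matrix n n ℝ) *
      diagonal (fun i => t * hA.eigenvalues i) *
        star (hA.eigenvectorUnitary : Matrix n n ℝ) := by
    conv_lhs => rw [hA.spectral_theorem, Unitary.conjStarAlgAut_apply]
    rw [← smul_mul_assoc, ← mul_smul_comm, ← diagonal_smul]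
    rfl
  rw [h]
  have := exp_units_conj (Unitary.toUnits hA.eigenvectorUnitary)
    (diagonal fun i => t * hA.eigenvalues i)
  rw [exp_diagonal] at this
  refine this.trans ?_
  congr 3
  ext i
  simp [Pi.coe_exp, Real.exp_eq_exp_ℝ]

/-- The flow of `-A`, with `A` positive semidefinite, sends every vector orthogonal to the kernel
of `A` to `0`. -/
lemma Matrix.PosSemidef.tendsto_exp_neg_smul_mulVec {n : Type*} [Fintype n] [DecidableEq n]
    {A : Matrix n n ℝ} (hA : A.PosSemidef) {z : n → ℝ}
    (hz : ∀ v, A *ᵥ v = 0 → v ⬝ᵥ z = 0) :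
    Tendsto (fun t : ℝ => NormedSpace.exp ((-t) • A) *ᵥ z) atTop (𝓝 0) := by
  set U : Matrix n n ℝ := ↑hA.isHermitian.eigenvectorUnitary with hU
  have hcoord : Tendsto (fun t : ℝ =>
      diagonal (fun i => Real.exp (-t * hA.isHermitian.eigenvalues i)) *ᵥ (star U *ᵥ z))
      atTop (𝓝 0) := by
    refine tendsto_pi_nhds.2 fun i => ?_
    simp only [mulVec_diagonal]
    rcases (hA.eigenvalues_nonneg i).eq_or_lt' with h0 | hpos
    · have hker := hA.isHermitian.mulVec_eigenvectorBasis i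
      rw [h0, zero_smul] at hker
      have : (star U *ᵥ z) i = 0 := by
        rw [← hz _ hker]
        simp [mulVec, dotProduct, hU, star_apply]
      simp [this]
    · have h : Tendsto (fun t : ℝ => -t * hA.isHermitian.eigenvalues i) atTop atBot :=
        tendsto_neg_atTop_atBot.atBot_mul_const hpos
      simpa using (Real.tendsto_exp_atBot.comp h).mul_const ((star U *ᵥ z) i)
  have hcont : Continuous fun w : n → ℝ => U *ᵥ w := by fun_prop
  have h := (hcont.tendsto 0).comp hcoord
  rw [mulVec_zero] at h
  refine h.congr fun t => ?_
  simp only [hA.isHermitian.exp_smul_eq, Function.comp_apply, mulVec_mulVec, hU, mul_assoc]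

/-- Edge-variable consensus dynamics: for `z₀` in the range of `Bᵀ`, the flow
`exp(−t BᵀB) z₀` of `ż = −BᵀB z` converges to `0` as `t → ∞`. -/
theorem edge_consensus_flow_tendsto_zero (N M : ℕ) (B : Matrix (Fin N) (Fin M) ℝ)
    (z₀ : Fin M → ℝ)
    (hz₀ : z₀ ∈ Set.range fun x : Fin N → ℝ => B.transpose.mulVec x) :
    Filter.Tendsto
      (fun t : ℝ => (NormedSpace.exp ((-t) • (B.transpose * B))).mulVec z₀)
      Filter.atTop (nhds 0) := by
  obtain ⟨x, rfl⟩ := hz₀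
  refine Matrix.PosSemidef.tendsto_exp_neg_smul_mulVec
    (by simpa using posSemidef_conjTranspose_mul_self B) fun v hv => ?_
  have hBv : B *ᵥ v = 0 := by
    rw [← dotProduct_self_eq_zero, dotProduct_mulVec, vecMul_mulVec, ← dotProduct_mulVec,
      hv, dotProduct_zero]
  rw [dotProduct_mulVec, vecMul_transpose, hBv, zero_dotProduct]
end
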